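/- Let q > 1 be real and c > 0 real. For p ∈ ℕ and n ∈ ℤ set φ_e^p(n) = ₁φ₁(q^{4p}; q^{−2}; q^{−4}, −c q^{4n−4p−2}) (a terminating sum, since (q^{4p};q^{−4})_j = 0 for j > p). Then for all r, s ∈ ℕ the family n ↦ φ_e^r(n) φ_e^s(n) q^{2n} / (−c q^{4n};q^{−4})_∞ is summable over ℤ and ∑_{n∈ℤ} φ_e^r(n) φ_e^s(n) q^{2n} / (−c q^{4n};q^{−4})_∞ = δ_{rs} · q^{4r} · [(q^{−4};q^{−4})_r (q^{−4};q^{−4})_∞ (−c q^{−2};q^{−4})_∞ (−q^{−2} c^{−1};q^{−4})_∞] / [(q^{−2};q^{−4})_r (q^{−2};q^{−4})_∞ (−c;q^{−4})_∞ (−q^{−4} c^{−1};q^{−4})_∞]. -/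

import Mathlib

open scoped BigOperators

/-- The q-shifted factorial `(a;p)_n = ∏_{i=0}^{n-1} (1 - a p^i)`. -/
noncomputable def qPoch (a p : ℂ) (n : ℕ) : ℂ :=
  ∏ i ∈ Finset.range n, (1 - a * p ^ i)

/-- The infinite q-shifted factorial `(a;p)_∞ = ∏_{i=0}^∞ (1 - a p^i)`. -/
noncomputable def qPochInf (a p : ℂ) : ℂ :=
  ∏' i : ℕ, (1 - a * p ^ i)

/-- The basic hypergeometric series
`₁φ₁(a;c;p,z) = ∑_{j=0}^∞ ((a;p)_j / ((p;p)_j (c;p)_j)) (-1)^j p^(j(j-1)/2) z^j`. -/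
noncomputable def phi11 (a c p z : ℂ) : ℂ :=
  ∑' j : ℕ, qPoch a p j / (qPoch p p j * qPoch c p j) * (-1) ^ j *
    p ^ (j * (j - 1) / 2) * z ^ j

/-- The even eigenfunctions `φ_e^p(n) = ₁φ₁(q^{4p}; q⁻²; q⁻⁴, -c q^{4n-4p-2})`. -/
noncomputable def phiE (q c : ℝ) (p : ℕ) (n : ℤ) : ℂ :=
  phi11 ((q : ℂ) ^ (4 * (p : ℤ))) ((q : ℂ) ^ (-2 : ℤ)) ((q : ℂ) ^ (-4 : ℤ))
    (-(c : ℂ) * (q : ℂ) ^ (4 * n - 4 * (p : ℤ) - 2))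

/-- The infinite product `∏ (1 + x p^i)`, that is `(-x;p)_∞`, over the reals. -/
noncomputable def eulerProd (p x : ℝ) : ℝ := ∏' i : ℕ, (1 + x * p ^ i)

section EulerProd

variable {p : ℝ}

lemma multipliable_eulerProd (hp0 : 0 < p) (hp1 : p < 1) (x : ℝ) :
    Multipliable fun i : ℕ => 1 + x * p ^ i :=
  Real.multipliable_one_add_of_summable
    ((summable_geometric_of_lt_one hp0.le hp1).mul_left x)

lemma tendsto_prod_eulerProd (hp0 : 0 < p) (hp1 : p < 1) (x : ℝ) :
    Filter.Tendsto (fun n : ℕ => ∏ i ∈ Finset.range n, (1 + x * p ^ i)) Filter.atTop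
      (nhds (eulerProd p x)) :=
  (multipliable_eulerProd hp0 hp1 x).tendsto_prod_tprod_nat

lemma eulerProd_eq_mul (hp0 : 0 < p) (hp1 : p < 1) (x : ℝ) :
    eulerProd p x = (1 + x) * eulerProd p (x * p) := by
  have h (i : ℕ) : 1 + x * p * p ^ i = 1 + x * p ^ (i + 1) := by ring
  have hm := multipliable_eulerProd hp0 hp1 (x * p)
  rw [funext h] at hm
  rw [eulerProd, eulerProd, funext h, tprod_eq_zero_mul' (f := fun i => 1 + x * p ^ i) hm]
  norm_num

lemma one_le_prod_one_add_mul_pow (hp0 : 0 < p) {x : ℝ} (hx : 0 ≤ x) (n : ℕ) :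
    1 ≤ ∏ i ∈ Finset.range n, (1 + x * p ^ i) :=
  Finset.one_le_prod fun i _ => le_add_of_nonneg_right (by positivity)

lemma one_le_eulerProd (hp0 : 0 < p) (hp1 : p < 1) {x : ℝ} (hx : 0 ≤ x) :
    1 ≤ eulerProd p x :=
  ge_of_tendsto' (tendsto_prod_eulerProd hp0 hp1 x) (one_le_prod_one_add_mul_pow hp0 hx)

lemma eulerProd_pos (hp0 : 0 < p) (hp1 : p < 1) {x : ℝ} (hx : 0 ≤ x) : 0 < eulerProd p x :=
  one_pos.trans_le (one_le_eulerProd hp0 hp1 hx)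

lemma prod_mul_eulerProd (hp0 : 0 < p) (hp1 : p < 1) (x : ℝ) (n : ℕ) :
    (∏ i ∈ Finset.range n, (1 + x * p ^ i)) * eulerProd p (x * p ^ n) = eulerProd p x := by
  induction n with
  | zero => simp
  | succ n ih =>
    rw [← ih, Finset.prod_range_succ, eulerProd_eq_mul hp0 hp1 (x * p ^ n), pow_succ]
    ring_nf

lemma eulerProd_zpow_succ (hp0 : 0 < p) (hp1 : p < 1) (c : ℝ) (k : ℤ) :
    eulerProd p (c * p ^ k) = (1 + c * p ^ k) * eulerProd p (c * p ^ (k + 1)) := by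
  rw [eulerProd_eq_mul hp0 hp1, zpow_add_one₀ hp0.ne', mul_assoc c]

lemma eulerProd_neg_ne_zero (hp0 : 0 < p) (hp1 : p < 1) {a : ℝ} (ha0 : 0 < a) (ha1 : a < 1) :
    eulerProd p (-a) ≠ 0 := by
  refine tprod_one_add_ne_zero_of_summable (f := fun i => -a * p ^ i) (fun i => ?_) ?_
  · have : a * p ^ i < 1 := mul_lt_one_of_nonneg_of_lt_one_left ha0.le ha1
      (pow_le_one₀ hp0.le hp1.le)
    linarith
  · exact ((summable_geometric_of_lt_one hp0.le hp1).mul_left (-a)).norm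

lemma tendsto_eulerProd_mul_pow (hp0 : 0 < p) (hp1 : p < 1) {c : ℝ} (hc : 0 < c) :
    Filter.Tendsto (fun n : ℕ => eulerProd p (c * p ^ n)) Filter.atTop (nhds 1) := by
  have hE := (eulerProd_pos hp0 hp1 hc.le).ne'
  have h := (tendsto_const_nhds (x := eulerProd p c)).div (tendsto_prod_eulerProd hp0 hp1 c) hE
  rw [div_self hE] at h
  refine h.congr fun n => ?_
  have := one_le_prod_one_add_mul_pow hp0 hc.le n
  rw [Pi.div_apply, ← prod_mul_eulerProd hp0 hp1 c n]
  field_simp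

lemma summable_zpow_div_eulerProd (hp0 : 0 < p) (hp1 : p < 1) {a c : ℝ} (ha0 : 0 < a)
    (ha1 : a < 1) (hc : 0 < c) :
    Summable fun k : ℤ => a ^ k / eulerProd p (c * p ^ k) := by
  refine Summable.of_nat_of_neg ?_ ?_
  · refine (summable_geometric_of_lt_one ha0.le ha1).of_nonneg_of_le (fun n => ?_) fun n => ?_
    · have := eulerProd_pos hp0 hp1 (x := c * p ^ (n : ℤ)) (by positivity)
      positivity
    · rw [zpow_natCast a]
      exact div_le_self (by positivity) (one_le_eulerProd hp0 hp1 (by positivity))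
  · have hpos (n : ℕ) : 0 < a ^ (-(n : ℤ)) / eulerProd p (c * p ^ (-(n : ℤ))) := by
      have := eulerProd_pos hp0 hp1 (x := c * p ^ (-(n : ℤ))) (by positivity)
      positivity
    refine summable_of_ratio_test_tendsto_lt_one (l := 0) one_pos
      (Filter.Eventually.of_forall fun n => (hpos n).ne') ?_
    have hlim : Filter.Tendsto (fun n : ℕ => a⁻¹ * (p / c) * p ^ n) Filter.atTop (nhds 0) := by
      simpa using (tendsto_pow_atTop_nhds_zero_of_lt_one hp0.le hp1).const_mul (a⁻¹ * (p / c))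
    refine squeeze_zero (fun n => by positivity) (fun n => ?_) hlim
    rw [Real.norm_of_nonneg (hpos _).le, Real.norm_of_nonneg (hpos _).le,
      div_le_iff₀ (hpos n)]
    have h1 := eulerProd_zpow_succ hp0 hp1 c (-((n + 1 : ℕ) : ℤ))
    have h2 : -((n + 1 : ℕ) : ℤ) + 1 = -(n : ℤ) := by push_cast; ring
    rw [h2] at h1
    have hE := eulerProd_pos hp0 hp1 (x := c * p ^ (-(n : ℤ))) (by positivity)
    have h3 (x : ℝ) (hx : x ≠ 0) : x ^ (-((n + 1 : ℕ) : ℤ)) = x⁻¹ * x ^ (-(n : ℤ)) := by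
      rw [← h2, zpow_add_one₀ hx]; field_simp
    have hA : 0 < a ^ (-(n : ℤ)) := by positivity
    have hP : p ^ n * p ^ (-(n : ℤ)) = 1 := by
      rw [← zpow_natCast, ← zpow_add₀ hp0.ne', add_neg_cancel, zpow_zero]
    have hP0 : 0 < p ^ (-(n : ℤ)) := by positivity
    rw [h1, h3 a ha0.ne', h3 p hp0.ne']
    generalize eulerProd p (c * p ^ (-(n : ℤ))) = E at hE
    generalize a ^ (-(n : ℤ)) = A at hA
    generalize p ^ (-(n : ℤ)) = P at hP hP0
    rw [div_le_iff₀ (by positivity)]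
    have : a⁻¹ * (p / c) * p ^ n * (A / E) * ((1 + c * (p⁻¹ * P)) * E) =
        (p / c * p ^ n + p ^ n * P) * (a⁻¹ * A) := by
      field_simp
    rw [this, hP]
    exact le_mul_of_one_le_left (by positivity) (le_add_of_nonneg_left (by positivity))

/-- The bilateral sum `∑ a^k / (-c p^k;p)_∞`. -/
noncomputable def bilateralSum (p c a : ℝ) : ℝ := ∑' k : ℤ, a ^ k / eulerProd p (c * p ^ k)

lemma bilateralSum_mul (hp0 : 0 < p) (hp1 : p < 1) {a c : ℝ} (ha0 : 0 < a) (ha1 : a < 1)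
    (hc : 0 < c) :
    a * c * bilateralSum p c (a * p) = (1 - a) * bilateralSum p c a := by
  have hs := summable_zpow_div_eulerProd hp0 hp1 ha0 ha1 hc
  have hs' := summable_zpow_div_eulerProd hp0 hp1 (mul_pos ha0 hp0)
    (mul_lt_one_of_nonneg_of_lt_one_left ha0.le ha1 hp1.le) hc
  have h : bilateralSum p c a = a * bilateralSum p c a + a * c * bilateralSum p c (a * p) := by
    conv_lhs => rw [bilateralSum, ← (Equiv.addRight (1 : ℤ)).tsum_eq]
    rw [bilateralSum, bilateralSum, ← tsum_mul_left, ← tsum_mul_left,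
      ← (hs.mul_left _).tsum_add (hs'.mul_left _)]
    refine tsum_congr fun k => ?_
    have hE := eulerProd_pos hp0 hp1 (x := c * p ^ (k + 1)) (by positivity)
    rw [Equiv.coe_addRight, eulerProd_zpow_succ hp0 hp1 c k, zpow_add_one₀ ha0.ne', mul_zpow]
    have : 0 < 1 + c * p ^ k := by positivity
    field_simp
  linarith

lemma bilateralSum_self (hp0 : 0 < p) (hp1 : p < 1) {c : ℝ} (hc : 0 < c) :
    bilateralSum p c p = c⁻¹ := by
  set g : ℤ → ℝ := fun k => (eulerProd p (c * p ^ k))⁻¹ with hg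
  have hs := (summable_zpow_div_eulerProd hp0 hp1 hp0 hp1 hc).mul_left c
  have hdiff (k : ℤ) : c * (p ^ k / eulerProd p (c * p ^ k)) = g (k + 1) - g k := by
    have hE := eulerProd_pos hp0 hp1 (x := c * p ^ (k + 1)) (by positivity)
    have : 0 < 1 + c * p ^ k := by positivity
    simp only [hg]
    rw [eulerProd_zpow_succ hp0 hp1 c k]
    field_simp
    ring
  have hs2 : Summable fun k : ℤ => g (k + 1) - g k := hs.congr fun k => (hdiff k)
  have hpos : HasSum (fun n : ℕ => g ((n : ℤ) + 1) - g n) (1 - g 0) := by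
    refine (hs2.comp_injective Nat.cast_injective).hasSum_iff_tendsto_nat.2 ?_
    have h1 : Filter.Tendsto (fun n : ℕ => g n) Filter.atTop (nhds 1) := by
      simpa [hg] using (tendsto_eulerProd_mul_pow hp0 hp1 hc).inv₀ one_ne_zero
    refine (h1.sub_const (g 0)).congr fun n => ?_
    simpa using (Finset.sum_range_sub (fun n : ℕ => g n) n).symm
  have hneg : HasSum (fun n : ℕ => g (-((n : ℤ) + 1) + 1) - g (-((n : ℤ) + 1))) (g 0) := by
    have hinj : Function.Injective fun n : ℕ => -((n : ℤ) + 1) := fun a b h => by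
      simpa using h
    refine (hs2.comp_injective hinj).hasSum_iff_tendsto_nat.2 ?_
    have h1 : Filter.Tendsto (fun n : ℕ => g (-(n : ℤ))) Filter.atTop (nhds 0) := by
      have hlim : Filter.Tendsto (fun n : ℕ => c⁻¹ * p ^ n) Filter.atTop (nhds 0) := by
        simpa using (tendsto_pow_atTop_nhds_zero_of_lt_one hp0.le hp1).const_mul c⁻¹
      refine squeeze_zero (fun n => ?_) (fun n => ?_) hlim
      · exact inv_nonneg.2 (eulerProd_pos hp0 hp1 (by positivity)).le
      · have h2 : c * p ^ (-(n : ℤ)) ≤ eulerProd p (c * p ^ (-(n : ℤ))) := by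
          rw [eulerProd_eq_mul hp0 hp1]
          have := one_le_eulerProd hp0 hp1 (x := c * p ^ (-(n : ℤ)) * p) (by positivity)
          have h4 : 0 < c * p ^ (-(n : ℤ)) := by positivity
          nlinarith
        refine (inv_anti₀ (by positivity) h2).trans_eq ?_
        simp [mul_comm]
    refine (((tendsto_const_nhds (x := g 0)).sub h1).congr fun n => ?_).trans (by simp)
    have := Finset.sum_range_sub (fun n : ℕ => -g (-(n : ℤ))) n
    simp only [Nat.cast_zero, neg_zero, Nat.cast_add, Nat.cast_one] at this
    rw [show g 0 - g (-(n : ℤ)) = -g (-(n : ℤ)) - -g 0 by ring, ← this]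
    refine Finset.sum_congr rfl fun i _ => ?_
    simp only [Function.comp_apply]
    rw [show -((i : ℤ) + 1) + 1 = -(i : ℤ) by ring]
    ring
  have h := (HasSum.of_nat_of_neg_add_one (f := fun k : ℤ => g (k + 1) - g k) hpos hneg).tsum_eq
  rw [sub_add_cancel, ← tsum_congr hdiff, tsum_mul_left] at h
  exact eq_inv_of_mul_eq_one_right h

/-- The theta product `(-c;p)_∞ (-p/c;p)_∞`. -/
noncomputable def thetaProd (p c : ℝ) : ℝ := eulerProd p c * eulerProd p (p / c)

lemma thetaProd_mul (hp0 : 0 < p) (hp1 : p < 1) {c : ℝ} (hc : 0 < c) :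
    c * thetaProd p (c * p) = thetaProd p c := by
  have h := eulerProd_eq_mul hp0 hp1 c⁻¹
  rw [thetaProd, thetaProd, eulerProd_eq_mul hp0 hp1 c,
    show p / (c * p) = c⁻¹ by field_simp, h, show c⁻¹ * p = p / c by ring]
  field_simp
  ring

/-- The term `a^m / ((-c p^m;p)_∞ (-p^{1-m}/c;p)_N)`. -/
noncomputable def truncTerm (p c a : ℝ) (N : ℕ) (m : ℤ) : ℝ :=
  a ^ m / (eulerProd p (c * p ^ m) * ∏ i ∈ Finset.range N, (1 + p ^ (1 - m) / c * p ^ i))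

lemma truncTerm_succ (hp0 : 0 < p) (hp1 : p < 1) {a c : ℝ} (ha0 : 0 < a) (hc : 0 < c)
    (N : ℕ) (m : ℤ) :
    truncTerm p c a (N + 1) (m + 1) =
      truncTerm p c a N (m + 1) - a * p ^ N * truncTerm p c a N m := by
  have hE := eulerProd_pos hp0 hp1 (x := c * p ^ (m + 1)) (by positivity)
  have hF := one_le_prod_one_add_mul_pow hp0 (x := p ^ (1 - m) / c) (by positivity) N
  have hF1 := one_le_prod_one_add_mul_pow hp0 (x := p ^ (1 - (m + 1)) / c) (by positivity) N
  have key : (∏ i ∈ Finset.range N, (1 + p ^ (1 - (m + 1)) / c * p ^ i)) *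
      (1 + p ^ (1 - (m + 1)) / c * p ^ N) =
      (1 + p ^ (-m) / c) * ∏ i ∈ Finset.range N, (1 + p ^ (1 - m) / c * p ^ i) := by
    rw [← Finset.prod_range_succ, Finset.prod_range_succ', mul_comm]
    congr 1
    · simp
    · refine Finset.prod_congr rfl fun i _ => ?_
      rw [show 1 - (m + 1) = -m by ring, sub_eq_add_neg, zpow_add₀ hp0.ne', pow_succ]
      simp only [zpow_one]
      ring
  rw [truncTerm, truncTerm, truncTerm, Finset.prod_range_succ, eulerProd_zpow_succ hp0 hp1 c m,
    zpow_add_one₀ ha0.ne']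
  set F := ∏ i ∈ Finset.range N, (1 + p ^ (1 - m) / c * p ^ i)
  set F1 := ∏ i ∈ Finset.range N, (1 + p ^ (1 - (m + 1)) / c * p ^ i)
  set E := eulerProd p (c * p ^ (m + 1))
  rw [show 1 - (m + 1) = -m by ring, zpow_neg] at key ⊢
  have hP : 0 < p ^ m := by positivity
  set P := p ^ m
  have h1 : 0 < 1 + P⁻¹ / c * p ^ N := by positivity
  have h2 : F1 = (1 + P⁻¹ / c) * F / (1 + P⁻¹ / c * p ^ N) := by
    rw [eq_div_iff h1.ne', key]
  rw [h2]
  have h3 : 0 < 1 + P⁻¹ / c := by positivity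
  field_simp
  ring

lemma truncTerm_nonneg (hp0 : 0 < p) (hp1 : p < 1) {a c : ℝ} (ha0 : 0 < a) (hc : 0 < c)
    (N : ℕ) (m : ℤ) :
    0 ≤ truncTerm p c a N m := by
  have hE := eulerProd_pos hp0 hp1 (x := c * p ^ m) (by positivity)
  have hF := one_le_prod_one_add_mul_pow hp0 (x := p ^ (1 - m) / c) (by positivity) N
  unfold truncTerm
  positivity

lemma truncTerm_le (hp0 : 0 < p) (hp1 : p < 1) {a c : ℝ} (ha0 : 0 < a) (hc : 0 < c)
    (N : ℕ) (m : ℤ) :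
    truncTerm p c a N m ≤ a ^ m / eulerProd p (c * p ^ m) := by
  have hE := eulerProd_pos hp0 hp1 (x := c * p ^ m) (by positivity)
  have hF := one_le_prod_one_add_mul_pow hp0 (x := p ^ (1 - m) / c) (by positivity) N
  exact div_le_div_of_nonneg_left (by positivity) hE (le_mul_of_one_le_right hE.le hF)

lemma tsum_truncTerm (hp0 : 0 < p) (hp1 : p < 1) {a c : ℝ} (ha0 : 0 < a) (ha1 : a < 1)
    (hc : 0 < c) (N : ℕ) :
    ∑' m : ℤ, truncTerm p c a N m =
      (∏ i ∈ Finset.range N, (1 + -a * p ^ i)) * bilateralSum p c a := by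
  induction N with
  | zero => simp [truncTerm, bilateralSum]
  | succ N ih =>
    have hs : Summable (truncTerm p c a N) :=
      (summable_zpow_div_eulerProd hp0 hp1 ha0 ha1 hc).of_nonneg_of_le
        (truncTerm_nonneg hp0 hp1 ha0 hc N) (truncTerm_le hp0 hp1 ha0 hc N)
    have hs1 : Summable fun m : ℤ => truncTerm p c a N (m + 1) :=
      (Equiv.addRight (1 : ℤ)).summable_iff.2 hs
    have hshift := (Equiv.addRight (1 : ℤ)).tsum_eq (truncTerm p c a N)
    rw [← (Equiv.addRight (1 : ℤ)).tsum_eq (truncTerm p c a (N + 1))]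
    simp only [Equiv.coe_addRight] at hshift ⊢
    rw [tsum_congr (truncTerm_succ hp0 hp1 ha0 hc N), hs1.tsum_sub (hs.mul_left _), hshift,
      tsum_mul_left, ih, Finset.prod_range_succ]
    ring

lemma thetaProd_zpow (hp0 : 0 < p) (c : ℝ) (m : ℤ) :
    eulerProd p (c * p ^ m) * eulerProd p (p ^ (1 - m) / c) = thetaProd p (c * p ^ m) := by
  rw [thetaProd, zpow_sub₀ hp0.ne', zpow_one, div_div, mul_comm c]

/-- Up to the factor `(a;p)_∞`, the bilateral sum is a sum of reciprocal theta products. -/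
lemma prod_mul_bilateralSum (hp0 : 0 < p) (hp1 : p < 1) {a c : ℝ} (ha0 : 0 < a) (ha1 : a < 1)
    (hc : 0 < c) :
    eulerProd p (-a) * bilateralSum p c a = ∑' m : ℤ, a ^ m / thetaProd p (c * p ^ m) := by
  have h1 : Filter.Tendsto (fun N => ∑' m : ℤ, truncTerm p c a N m) Filter.atTop
      (nhds (∑' m : ℤ, a ^ m / thetaProd p (c * p ^ m))) := by
    refine tendsto_tsum_of_dominated_convergence
      (summable_zpow_div_eulerProd hp0 hp1 ha0 ha1 hc) (fun m => ?_)
      (Filter.Eventually.of_forall fun N m => ?_)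
    · have hE := eulerProd_pos hp0 hp1 (x := c * p ^ m) (by positivity)
      have hE' := eulerProd_pos hp0 hp1 (x := p ^ (1 - m) / c) (by positivity)
      rw [← thetaProd_zpow hp0]
      exact tendsto_const_nhds.div ((tendsto_prod_eulerProd hp0 hp1 _).const_mul _)
        (mul_pos hE hE').ne'
    · rw [Real.norm_of_nonneg (truncTerm_nonneg hp0 hp1 ha0 hc N m)]
      exact truncTerm_le hp0 hp1 ha0 hc N m
  simp only [tsum_truncTerm hp0 hp1 ha0 ha1 hc] at h1
  exact tendsto_nhds_unique ((tendsto_prod_eulerProd hp0 hp1 (-a)).mul_const _) h1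

lemma zpow_mul_thetaProd_div (hp0 : 0 < p) (hp1 : p < 1) {a b c d : ℝ} (ha : 0 < a) (hb : 0 < b)
    (hc : 0 < c) (hd : 0 < d) (h : a * c = b * d) (m : ℤ) :
    thetaProd p c * (a ^ m / thetaProd p (c * p ^ m)) =
      thetaProd p d * (b ^ m / thetaProd p (d * p ^ m)) := by
  have pos {x : ℝ} (hx : 0 < x) : 0 < thetaProd p x :=
    mul_pos (eulerProd_pos hp0 hp1 hx.le) (eulerProd_pos hp0 hp1 (by positivity))
  have step {a c : ℝ} (ha : 0 < a) (hc : 0 < c) (m : ℤ) :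
      a ^ (m + 1) / thetaProd p (c * p ^ (m + 1)) =
        a * c * p ^ m * (a ^ m / thetaProd p (c * p ^ m)) := by
    have h1 := thetaProd_mul hp0 hp1 (c := c * p ^ m) (by positivity)
    rw [mul_assoc c (p ^ m) p, ← zpow_add_one₀ hp0.ne'] at h1
    have := pos (x := c * p ^ (m + 1)) (by positivity)
    rw [← h1, zpow_add_one₀ ha.ne']
    field_simp
  induction m using Int.induction_on with
  | zero => simp [(pos hc).ne', (pos hd).ne']
  | succ n ih =>
    rw [step ha hc, step hb hd, ← h]
    linear_combination a * c * p ^ (n : ℤ) * ih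
  | pred n ih =>
    have h1 := step ha hc (-(n : ℤ) - 1)
    have h2 := step hb hd (-(n : ℤ) - 1)
    rw [sub_add_cancel] at h1 h2
    rw [h1, h2, ← h] at ih
    refine mul_left_cancel₀ (a := a * c * p ^ (-(n : ℤ) - 1)) (by positivity) ?_
    linear_combination ih

/-- Ramanujan's summation in the degenerate case of a vanishing lower parameter. -/
theorem bilateralSum_eq (hp0 : 0 < p) (hp1 : p < 1) {a c : ℝ} (ha0 : 0 < a) (ha1 : a < 1)
    (hc : 0 < c) :
    bilateralSum p c a = eulerProd p (-p) * eulerProd p (c * a) * eulerProd p (p / (c * a)) /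
      (eulerProd p (-a) * eulerProd p c * eulerProd p (p / c)) := by
  have hd : 0 < a * c / p := by positivity
  have h1 := prod_mul_bilateralSum hp0 hp1 ha0 ha1 hc
  have h2 := prod_mul_bilateralSum hp0 hp1 hp0 hp1 hd
  have h3 := tsum_congr (L := .unconditional ℤ)
    (zpow_mul_thetaProd_div hp0 hp1 ha0 hp0 hc hd (by field_simp))
  rw [tsum_mul_left, tsum_mul_left, ← h1, ← h2, bilateralSum_self hp0 hp1 hd,
    ← thetaProd_mul hp0 hp1 hd, show a * c / p * p = c * a by field_simp, thetaProd,
    thetaProd] at h3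
  have hE := eulerProd_neg_ne_zero hp0 hp1 ha0 ha1
  have hE1 := eulerProd_pos hp0 hp1 hc.le
  have hE2 := eulerProd_pos hp0 hp1 (x := p / c) (by positivity)
  rw [eq_div_iff (by positivity)]
  field_simp at h3
  linear_combination h3

end EulerProd

section QLaguerre

open Finset

lemma qPoch_succ (a p : ℂ) (n : ℕ) : qPoch a p (n + 1) = qPoch a p n * (1 - a * p ^ n) :=
  prod_range_succ _ _

lemma qPoch_succ' (a p : ℂ) (n : ℕ) : qPoch a p (n + 1) = (1 - a) * qPoch (a * p) p n := by
  rw [qPoch, prod_range_succ', mul_comm, qPoch]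
  simp only [pow_zero, mul_one, pow_succ', mul_assoc]

lemma qPoch_inv_pow_eq_zero {p : ℂ} (hp : p ≠ 0) {d n : ℕ} (h : d < n) :
    qPoch (p ^ d)⁻¹ p n = 0 :=
  prod_eq_zero (mem_range.2 h) (by rw [inv_mul_cancel₀ (pow_ne_zero _ hp), sub_self])

lemma inv_pow_succ_mul {p : ℂ} (hp : p ≠ 0) (r : ℕ) : (p ^ (r + 1))⁻¹ * p = (p ^ r)⁻¹ := by
  rw [pow_succ]
  field_simp

lemma qPoch_inv_pow_sq {p : ℂ} (hp : p ≠ 0) (r : ℕ) :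
    qPoch (p ^ r)⁻¹ p r ^ 2 * p ^ (r * r) * p ^ r = qPoch p p r ^ 2 := by
  induction r with
  | zero => simp [qPoch]
  | succ r ih =>
    rw [qPoch_succ', inv_pow_succ_mul hp, qPoch_succ, mul_pow, mul_pow, ← ih,
      show (r + 1) * (r + 1) = r * r + r + (r + 1) by ring, pow_add, pow_add, pow_succ]
    field_simp
    ring

/-- The terminating `q`-binomial theorem. -/
lemma sum_qPoch_inv_pow_div {p : ℂ} (hp : p ≠ 0) (hpp : ∀ n, qPoch p p n ≠ 0) (r : ℕ) (y : ℂ) :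
    ∑ j ∈ range (r + 1), qPoch (p ^ r)⁻¹ p j / qPoch p p j * y ^ j =
      qPoch ((p ^ r)⁻¹ * y) p r := by
  induction r with
  | zero => simp [qPoch]
  | succ r ih =>
    have step (j : ℕ) : qPoch (p ^ (r + 1))⁻¹ p (j + 1) / qPoch p p (j + 1) * y ^ (j + 1) =
        qPoch (p ^ r)⁻¹ p (j + 1) / qPoch p p (j + 1) * y ^ (j + 1) -
          (p ^ (r + 1))⁻¹ * y * (qPoch (p ^ r)⁻¹ p j / qPoch p p j * y ^ j) := by
      have h1 := hpp j
      have h2 := hpp (j + 1)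
      rw [qPoch_succ' (p ^ (r + 1))⁻¹, inv_pow_succ_mul hp, qPoch_succ (p ^ r)⁻¹]
      rw [qPoch_succ] at h2 ⊢
      have h3 := right_ne_zero_of_mul h2
      field_simp
      ring
    have hlast := sum_range_succ (fun j => qPoch (p ^ r)⁻¹ p j / qPoch p p j * y ^ j) (r + 1)
    rw [qPoch_inv_pow_eq_zero hp r.lt_succ_self, zero_div, zero_mul, add_zero, ih,
      sum_range_succ'] at hlast
    rw [sum_range_succ', sum_congr rfl fun j _ => step j, sum_sub_distrib, ← mul_sum, ih,
      qPoch_succ', mul_right_comm _ y p, inv_pow_succ_mul hp]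
    simp only [qPoch, range_zero, prod_empty] at hlast ⊢
    linear_combination hlast

lemma sum_qPoch_inv_pow_div_mul_eval {p : ℂ} (hp : p ≠ 0) (hpp : ∀ n, qPoch p p n ≠ 0) (r : ℕ)
    (Q : Polynomial ℂ) (hQ : Q.natDegree ≤ r) :
    ∑ j ∈ range (r + 1), qPoch (p ^ r)⁻¹ p j / qPoch p p j * (p ^ r) ^ j * Q.eval (p ^ j)⁻¹ =
      Q.coeff r * qPoch (p ^ r)⁻¹ p r := by
  simp only [Polynomial.eval_eq_sum_range' (Nat.lt_succ_of_le hQ), mul_sum]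
  rw [sum_comm, sum_range_succ, sum_eq_zero, zero_add]
  · rw [← mul_one (p ^ r)⁻¹, ← sum_qPoch_inv_pow_div hp hpp, mul_sum]
    refine sum_congr rfl fun j _ => ?_
    rw [inv_pow, ← pow_mul, ← pow_mul, mul_comm r j]
    field_simp
    simp
  · intro d hd
    have h := sum_qPoch_inv_pow_div hp hpp r (p ^ r * (p ^ d)⁻¹)
    rw [← mul_assoc, inv_mul_cancel₀ (pow_ne_zero _ hp), one_mul,
      qPoch_inv_pow_eq_zero hp (mem_range.1 hd)] at h
    rw [← mul_zero (Q.coeff d), ← h, mul_sum]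
    refine sum_congr rfl fun j _ => ?_
    rw [mul_pow, inv_pow, inv_pow, ← pow_mul p d, ← pow_mul p j, mul_comm d j]
    ring

/-- The coefficient of `x^j` in the `q`-Laguerre polynomial `₁φ₁(p^{-r}; h; p, -p^r h x)`. -/
noncomputable def qLaguerreCoeff (p h : ℂ) (r j : ℕ) : ℂ :=
  qPoch (p ^ r)⁻¹ p j / (qPoch p p j * qPoch h p j) * p ^ (j * (j - 1) / 2) * (p ^ r * h) ^ j

/-- The `q`-Laguerre polynomial `₁φ₁(p^{-r}; h; p, -p^r h x)`. -/
noncomputable def qLaguerre (p h : ℂ) (r : ℕ) (x : ℂ) : ℂ :=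
  ∑ j ∈ range (r + 1), qLaguerreCoeff p h r j * x ^ j

/-- The polynomial `∏_{i<m} (X - h p^i)`. -/
noncomputable def nodePoly (p h : ℂ) (m : ℕ) : Polynomial ℂ :=
  ∏ i ∈ range m, (Polynomial.X - Polynomial.C (h * p ^ i))

lemma nodePoly_monic (p h : ℂ) (m : ℕ) : (nodePoly p h m).Monic :=
  Polynomial.monic_prod_of_monic _ _ fun _ _ => Polynomial.monic_X_sub_C _

lemma natDegree_nodePoly (p h : ℂ) (m : ℕ) : (nodePoly p h m).natDegree = m := by
  rw [nodePoly, Polynomial.natDegree_prod_of_monic _ _ fun _ _ => Polynomial.monic_X_sub_C _]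
  simp only [Polynomial.natDegree_X_sub_C, sum_const, card_range, smul_eq_mul, mul_one]

lemma triangular_succ (j : ℕ) : (j + 1) * (j + 1 - 1) / 2 = j * (j - 1) / 2 + j := by
  rw [← Nat.choose_two_right, ← Nat.choose_two_right, Nat.choose_succ_succ' j 1,
    Nat.choose_one_right, add_comm]

variable {p h : ℂ} {M : ℕ → ℂ}

lemma qLaguerreCoeff_mul_moment (hp : p ≠ 0) (hh : h ≠ 0) (hhp : ∀ n, qPoch h p n ≠ 0)
    (hM : ∀ j, h * p ^ j * M (j + 1) = (1 - h * p ^ j) * M j) (r j m : ℕ) :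
    qLaguerreCoeff p h r j * M (j + m) = M 0 / (∏ i ∈ range m, (h * p ^ i)) *
      (qPoch (p ^ r)⁻¹ p j / qPoch p p j * (p ^ r) ^ j * (nodePoly p h m).eval (p ^ j)⁻¹) := by
  induction m with
  | zero =>
    have h0 : p ^ (j * (j - 1) / 2) * h ^ j * M j = qPoch h p j * M 0 := by
      clear hhp
      induction j with
      | zero => simp [qPoch]
      | succ j ih =>
        rw [triangular_succ, pow_add, pow_succ, qPoch_succ]
        linear_combination p ^ (j * (j - 1) / 2) * h ^ j * hM j + (1 - h * p ^ j) * ih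
    have := hhp j
    simp only [qLaguerreCoeff, nodePoly, range_zero, prod_empty, Polynomial.eval_one, mul_pow,
      add_zero, div_one, mul_one]
    rw [div_mul_eq_div_div]
    calc _ = qPoch (p ^ r)⁻¹ p j / qPoch p p j / qPoch h p j * (p ^ r) ^ j *
          (p ^ (j * (j - 1) / 2) * h ^ j * M j) := by ring
      _ = _ := by rw [h0]; field_simp
  | succ m ih =>
    have h1 : M (j + (m + 1)) = M (j + m) * ((p ^ j)⁻¹ - h * p ^ m) / (h * p ^ m) := by
      have := hM (j + m)
      rw [pow_add] at this
      rw [eq_div_iff (by positivity), ← add_assoc]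
      field_simp
      linear_combination this
    rw [h1, prod_range_succ, nodePoly, prod_range_succ, ← nodePoly, Polynomial.eval_mul,
      Polynomial.eval_sub, Polynomial.eval_X, Polynomial.eval_C, mul_div_assoc', ← mul_assoc, ih,
      div_mul_eq_div_div]
    ring

lemma sum_qLaguerreCoeff_mul_moment (hp : p ≠ 0) (hh : h ≠ 0) (hpp : ∀ n, qPoch p p n ≠ 0)
    (hhp : ∀ n, qPoch h p n ≠ 0) (hM : ∀ j, h * p ^ j * M (j + 1) = (1 - h * p ^ j) * M j)
    {r m : ℕ} (hm : m ≤ r) :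
    ∑ j ∈ range (r + 1), qLaguerreCoeff p h r j * M (j + m) =
      if m = r then M 0 / (∏ i ∈ range r, (h * p ^ i)) * qPoch (p ^ r)⁻¹ p r else 0 := by
  simp only [qLaguerreCoeff_mul_moment hp hh hhp hM]
  rw [← mul_sum, sum_qPoch_inv_pow_div_mul_eval hp hpp r _ ((natDegree_nodePoly p h m).trans_le hm)]
  split_ifs with h1
  · subst h1
    have h2 := (nodePoly_monic p h m).coeff_natDegree
    rw [natDegree_nodePoly] at h2
    rw [h2, one_mul]
  · rw [Polynomial.coeff_eq_zero_of_natDegree_lt, zero_mul, mul_zero]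
    rw [natDegree_nodePoly]
    omega

lemma prod_mul_pow (h p : ℂ) (r : ℕ) :
    ∏ i ∈ range r, (h * p ^ i) = p ^ (r * (r - 1) / 2) * h ^ r := by
  rw [prod_mul_distrib, prod_pow_eq_pow_sum, sum_range_id, prod_const, card_range, mul_comm]

lemma sum_sum_qLaguerreCoeff_of_le (hp : p ≠ 0) (hh : h ≠ 0) (hpp : ∀ n, qPoch p p n ≠ 0)
    (hhp : ∀ n, qPoch h p n ≠ 0) (hM : ∀ j, h * p ^ j * M (j + 1) = (1 - h * p ^ j) * M j)
    {r s : ℕ} (hs : s ≤ r) :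
    ∑ j ∈ range (r + 1), ∑ i ∈ range (s + 1),
        qLaguerreCoeff p h r j * qLaguerreCoeff p h s i * M (j + i) =
      (if r = s then 1 else 0) * (p ^ r)⁻¹ * (qPoch p p r / qPoch h p r) * M 0 := by
  have h1 : ∀ i ∈ range (s + 1), ∑ j ∈ range (r + 1),
      qLaguerreCoeff p h r j * qLaguerreCoeff p h s i * M (j + i) =
      qLaguerreCoeff p h s i *
        if i = r then M 0 / (∏ i ∈ range r, (h * p ^ i)) * qPoch (p ^ r)⁻¹ p r else 0 := by
    intro i hi
    rw [← sum_qLaguerreCoeff_mul_moment hp hh hpp hhp hM (by rw [mem_range] at hi; omega), mul_sum]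
    exact sum_congr rfl fun j _ => by ring
  rw [sum_comm, sum_congr rfl h1]
  simp only [mul_ite, mul_zero, sum_ite_eq', mem_range]
  rcases hs.eq_or_lt with rfl | hlt
  · have h2 := qPoch_inv_pow_sq hp s
    have h3 := hpp s
    have h4 := hhp s
    rw [if_pos s.lt_succ_self, if_pos rfl, prod_mul_pow, qLaguerreCoeff, mul_pow, ← pow_mul]
    generalize qPoch (p ^ s)⁻¹ p s = Q at h2
    field_simp
    linear_combination M 0 * h2
  · rw [if_neg (by omega), if_neg hlt.ne']
    ring

lemma sum_sum_qLaguerreCoeff (hp : p ≠ 0) (hh : h ≠ 0) (hpp : ∀ n, qPoch p p n ≠ 0)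
    (hhp : ∀ n, qPoch h p n ≠ 0) (hM : ∀ j, h * p ^ j * M (j + 1) = (1 - h * p ^ j) * M j)
    (r s : ℕ) :
    ∑ j ∈ range (r + 1), ∑ i ∈ range (s + 1),
        qLaguerreCoeff p h r j * qLaguerreCoeff p h s i * M (j + i) =
      (if r = s then 1 else 0) * (p ^ r)⁻¹ * (qPoch p p r / qPoch h p r) * M 0 := by
  rcases le_total s r with hs | hs
  · exact sum_sum_qLaguerreCoeff_of_le hp hh hpp hhp hM hs
  · have h1 := sum_sum_qLaguerreCoeff_of_le hp hh hpp hhp hM hs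
    rw [sum_comm]
    simp only [mul_comm (qLaguerreCoeff p h r _), add_comm _ _] at h1 ⊢
    rw [h1]
    by_cases hrs : r = s
    · subst hrs; rfl
    · simp [hrs, Ne.symm hrs]

end QLaguerre

lemma qPochInf_neg_ofReal {p : ℝ} (hp0 : 0 < p) (hp1 : p < 1) (x : ℝ) :
    qPochInf (-(x : ℂ)) p = eulerProd p x := by
  have h := (multipliable_eulerProd hp0 hp1 x).map_tprod Complex.ofRealHom
    Complex.continuous_ofReal
  rw [eulerProd, qPochInf]
  refine Eq.trans (tprod_congr fun i => ?_) h.symm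
  simp

lemma qPoch_ofReal_ne_zero {p a : ℝ} (hp0 : 0 < p) (hp1 : p < 1) (ha0 : 0 < a) (ha1 : a < 1)
    (n : ℕ) : qPoch a p n ≠ 0 := by
  refine Finset.prod_ne_zero_iff.2 fun i _ => ?_
  have : a * p ^ i < 1 := mul_lt_one_of_nonneg_of_lt_one_left ha0.le ha1
    (pow_le_one₀ hp0.le hp1.le)
  exact_mod_cast (sub_pos.2 this).ne'

/-- Discrete orthogonality of the `q`-Laguerre polynomials. -/
theorem hasSum_qLaguerre {p h c : ℝ} (hp0 : 0 < p) (hp1 : p < 1) (hh0 : 0 < h) (hh1 : h < 1)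
    (hc : 0 < c) (r s : ℕ) :
    HasSum (fun k : ℤ => qLaguerre p h r (c * (p : ℂ) ^ k) * qLaguerre p h s (c * (p : ℂ) ^ k) *
        (h : ℂ) ^ k / qPochInf (-(c * (p : ℂ) ^ k)) p)
      ((if r = s then 1 else 0) * ((p : ℂ) ^ r)⁻¹ * (qPoch p p r / qPoch h p r) *
        (qPochInf p p * qPochInf (-(c * h)) p * qPochInf (-(p / (c * h))) p /
          (qPochInf h p * qPochInf (-c) p * qPochInf (-(p / c)) p))) := by
  have hb0 (j : ℕ) : 0 < h * p ^ j := by positivity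
  have hb1 (j : ℕ) : h * p ^ j < 1 :=
    mul_lt_one_of_nonneg_of_lt_one_left hh0.le hh1 (pow_le_one₀ hp0.le hp1.le)
  set M : ℕ → ℝ := fun j => c ^ j * bilateralSum p c (h * p ^ j) with hMdef
  have hM (j : ℕ) : h * p ^ j * M (j + 1) = (1 - h * p ^ j) * M j := by
    have := bilateralSum_mul hp0 hp1 (hb0 j) (hb1 j) hc
    rw [mul_assoc h (p ^ j) p, ← pow_succ] at this
    simp only [hMdef, pow_succ c]
    linear_combination c ^ j * this
  have hMC (j : ℕ) : (h : ℂ) * (p : ℂ) ^ j * (M (j + 1) : ℂ) =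
      (1 - (h : ℂ) * (p : ℂ) ^ j) * (M j : ℂ) := by exact_mod_cast hM j
  have hsum (j : ℕ) : HasSum (fun k : ℤ => (c * (p : ℂ) ^ k) ^ j *
      ((h : ℂ) ^ k / qPochInf (-(c * (p : ℂ) ^ k)) p)) (M j : ℂ) := by
    have h1 := (summable_zpow_div_eulerProd hp0 hp1 (hb0 j) (hb1 j) hc).hasSum.mul_left (c ^ j)
    refine (Complex.hasSum_ofReal.2 h1).congr_fun fun k => ?_
    have h2 := qPochInf_neg_ofReal hp0 hp1 (c * p ^ k)
    push_cast at h2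
    rw [h2]
    push_cast
    rw [mul_zpow, mul_pow, ← zpow_natCast ((p : ℂ) ^ k), ← zpow_natCast (p : ℂ), ← zpow_mul,
      ← zpow_mul, mul_comm k]
    ring
  have hM0 : (M 0 : ℂ) = qPochInf p p * qPochInf (-(c * h)) p * qPochInf (-(p / (c * h))) p /
      (qPochInf h p * qPochInf (-c) p * qPochInf (-(p / c)) p) := by
    have h1 := qPochInf_neg_ofReal hp0 hp1
    have e1 := h1 (-p)
    have e2 := h1 (c * h)
    have e3 := h1 (p / (c * h))
    have e4 := h1 (-h)
    have e5 := h1 (p / c)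
    push_cast at e1 e2 e3 e4 e5
    rw [neg_neg] at e1 e4
    rw [e1, e2, e3, e4, e5, h1 c, hMdef]
    simp only [pow_zero, one_mul, mul_one]
    rw [bilateralSum_eq hp0 hp1 hh0 hh1 hc]
    push_cast
    rfl
  rw [← hM0, ← sum_sum_qLaguerreCoeff (M := fun j => (M j : ℂ))
    (Complex.ofReal_ne_zero.2 hp0.ne') (Complex.ofReal_ne_zero.2 hh0.ne')
    (qPoch_ofReal_ne_zero hp0 hp1 hp0 hp1) (qPoch_ofReal_ne_zero hp0 hp1 hh0 hh1) hMC r s]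
  refine (hasSum_sum fun j _ => hasSum_sum fun i _ => (hsum (j + i)).mul_left
    (qLaguerreCoeff p h r j * qLaguerreCoeff p h s i)).congr_fun fun k => ?_
  rw [qLaguerre, qLaguerre, Finset.sum_mul_sum, mul_div_assoc, Finset.sum_mul]
  refine Finset.sum_congr rfl fun j _ => ?_
  rw [Finset.sum_mul]
  refine Finset.sum_congr rfl fun i _ => ?_
  rw [pow_add]
  ring

lemma phiE_eq_qLaguerre {q : ℝ} (hq : 0 < q) (c : ℝ) (r : ℕ) (n : ℤ) :
    phiE q c r n = qLaguerre ((q : ℂ) ^ (-4 : ℤ)) ((q : ℂ) ^ (-2 : ℤ)) r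
      (c * ((q : ℂ) ^ (-4 : ℤ)) ^ (-n)) := by
  have hqc : (q : ℂ) ≠ 0 := Complex.ofReal_ne_zero.2 hq.ne'
  have h1 : (q : ℂ) ^ (4 * (r : ℤ)) = (((q : ℂ) ^ (-4 : ℤ)) ^ r)⁻¹ := by
    rw [← zpow_natCast, ← zpow_mul, ← zpow_neg]; congr 1; ring
  have h2 : -(c : ℂ) * (q : ℂ) ^ (4 * n - 4 * (r : ℤ) - 2) =
      -(((q : ℂ) ^ (-4 : ℤ)) ^ r * (q : ℂ) ^ (-2 : ℤ) * (c * ((q : ℂ) ^ (-4 : ℤ)) ^ (-n))) := by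
    rw [show 4 * n - 4 * (r : ℤ) - 2 = -4 * r + -2 + -4 * (-n) by ring, zpow_add₀ hqc,
      zpow_add₀ hqc, zpow_mul, zpow_mul, zpow_natCast]
    ring
  rw [phiE, phi11, qLaguerre, h1, h2, tsum_eq_sum (s := Finset.range (r + 1))]
  · refine Finset.sum_congr rfl fun j _ => ?_
    rw [qLaguerreCoeff, neg_pow (_ * _)]
    have h3 : ((-1 : ℂ) ^ j) * (-1) ^ j = 1 := by rw [← mul_pow]; simp
    rw [mul_pow _ ((c : ℂ) * _)]
    linear_combination (qPoch (((q : ℂ) ^ (-4 : ℤ)) ^ r)⁻¹ ((q : ℂ) ^ (-4 : ℤ)) j /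
      (qPoch ((q : ℂ) ^ (-4 : ℤ)) ((q : ℂ) ^ (-4 : ℤ)) j *
        qPoch ((q : ℂ) ^ (-2 : ℤ)) ((q : ℂ) ^ (-4 : ℤ)) j)) *
      ((q : ℂ) ^ (-4 : ℤ)) ^ (j * (j - 1) / 2) *
      (((q : ℂ) ^ (-4 : ℤ)) ^ r * (q : ℂ) ^ (-2 : ℤ)) ^ j *
      ((c : ℂ) * ((q : ℂ) ^ (-4 : ℤ)) ^ (-n)) ^ j * h3
  · intro j hj
    rw [qPoch_inv_pow_eq_zero (zpow_ne_zero _ hqc) (by rw [Finset.mem_range] at hj; omega)]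
    simp

/-- Orthogonality of the even eigenfunctions:
`∑_{n∈ℤ} φ_e^r(n) φ_e^s(n) q^{2n} / (-c q^{4n};q⁻⁴)_∞
  = δ_{rs} q^{4r} (q⁻⁴;q⁻⁴)_r (q⁻⁴;q⁻⁴)_∞ (-cq⁻²;q⁻⁴)_∞ (-q⁻²c⁻¹;q⁻⁴)_∞
      / ((q⁻²;q⁻⁴)_r (q⁻²;q⁻⁴)_∞ (-c;q⁻⁴)_∞ (-q⁻⁴c⁻¹;q⁻⁴)_∞)`,
the family being summable. -/
theorem phiE_orthogonality (q c : ℝ) (hq : 1 < q) (hc : 0 < c) (r s : ℕ) :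
    Summable (fun n : ℤ => phiE q c r n * phiE q c s n * (q : ℂ) ^ (2 * n) /
      qPochInf (-(c : ℂ) * (q : ℂ) ^ (4 * n)) ((q : ℂ) ^ (-4 : ℤ))) ∧
    ∑' n : ℤ, phiE q c r n * phiE q c s n * (q : ℂ) ^ (2 * n) /
        qPochInf (-(c : ℂ) * (q : ℂ) ^ (4 * n)) ((q : ℂ) ^ (-4 : ℤ)) =
      (if r = s then 1 else 0) * (q : ℂ) ^ (4 * (r : ℤ)) *
        (qPoch ((q : ℂ) ^ (-4 : ℤ)) ((q : ℂ) ^ (-4 : ℤ)) r *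
          qPochInf ((q : ℂ) ^ (-4 : ℤ)) ((q : ℂ) ^ (-4 : ℤ)) *
          qPochInf (-(c : ℂ) * (q : ℂ) ^ (-2 : ℤ)) ((q : ℂ) ^ (-4 : ℤ)) *
          qPochInf (-(q : ℂ) ^ (-2 : ℤ) * (c : ℂ)⁻¹) ((q : ℂ) ^ (-4 : ℤ))) /
        (qPoch ((q : ℂ) ^ (-2 : ℤ)) ((q : ℂ) ^ (-4 : ℤ)) r *
          qPochInf ((q : ℂ) ^ (-2 : ℤ)) ((q : ℂ) ^ (-4 : ℤ)) *
          qPochInf (-(c : ℂ)) ((q : ℂ) ^ (-4 : ℤ)) *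
          qPochInf (-(q : ℂ) ^ (-4 : ℤ) * (c : ℂ)⁻¹) ((q : ℂ) ^ (-4 : ℤ))) := by
  have hq0 : 0 < q := one_pos.trans hq
  have hqc : (q : ℂ) ≠ 0 := Complex.ofReal_ne_zero.2 hq0.ne'
  have hp0 : 0 < q ^ (-4 : ℤ) := by positivity
  have hp1 : q ^ (-4 : ℤ) < 1 := zpow_lt_one_of_neg₀ hq (by norm_num)
  have hh0 : 0 < q ^ (-2 : ℤ) := by positivity
  have hh1 : q ^ (-2 : ℤ) < 1 := zpow_lt_one_of_neg₀ hq (by norm_num)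
  have hmain := (Equiv.neg ℤ).hasSum_iff.2 (hasSum_qLaguerre hp0 hp1 hh0 hh1 hc r s)
  push_cast at hmain
  have hz (n : ℤ) : ((q : ℂ) ^ (-4 : ℤ)) ^ (-n) = (q : ℂ) ^ (4 * n) := by
    rw [← zpow_mul]; congr 1; ring
  have hz2 (n : ℤ) : ((q : ℂ) ^ (-2 : ℤ)) ^ (-n) = (q : ℂ) ^ (2 * n) := by
    rw [← zpow_mul]; congr 1; ring
  have hterm (n : ℤ) : phiE q c r n * phiE q c s n * (q : ℂ) ^ (2 * n) /
      qPochInf (-(c : ℂ) * (q : ℂ) ^ (4 * n)) ((q : ℂ) ^ (-4 : ℤ)) =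
      qLaguerre ((q : ℂ) ^ (-4 : ℤ)) ((q : ℂ) ^ (-2 : ℤ)) r (c * ((q : ℂ) ^ (-4 : ℤ)) ^ (-n)) *
        qLaguerre ((q : ℂ) ^ (-4 : ℤ)) ((q : ℂ) ^ (-2 : ℤ)) s (c * ((q : ℂ) ^ (-4 : ℤ)) ^ (-n)) *
        ((q : ℂ) ^ (-2 : ℤ)) ^ (-n) /
        qPochInf (-(c * ((q : ℂ) ^ (-4 : ℤ)) ^ (-n))) ((q : ℂ) ^ (-4 : ℤ)) := by
    rw [phiE_eq_qLaguerre hq0, phiE_eq_qLaguerre hq0, hz2, hz, neg_mul]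
  simp only [Function.comp_def, Equiv.neg_apply, ← hterm] at hmain
  refine ⟨hmain.summable, hmain.tsum_eq.trans ?_⟩
  have h1 : (((q : ℂ) ^ (-4 : ℤ)) ^ r)⁻¹ = (q : ℂ) ^ (4 * (r : ℤ)) := by
    rw [← zpow_natCast, ← zpow_neg, hz]
  have h2 : (q : ℂ) ^ (-4 : ℤ) / (c * (q : ℂ) ^ (-2 : ℤ)) = (q : ℂ) ^ (-2 : ℤ) * (c : ℂ)⁻¹ := by
    rw [show (-4 : ℤ) = -2 + -2 by norm_num, zpow_add₀ hqc]
    have := zpow_ne_zero (-2) hqc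
    field_simp
  rw [h1, h2]
  simp only [neg_mul, div_eq_mul_inv, mul_inv]
  ring
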